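/- CVaR decomposition for finite probability spaces: let (Ω, P) be a finite probability space, Z : Ω → ℝ, and W : Ω → 𝒮 a map to a finite set 𝒮 with pushforward distribution p_W. Then for every α ∈ (0,1]: CVaR_α[Z] = min over ξ̃ ∈ U_α(p_W) of Σ_{s' : p_W(s') > 0} p_W(s')·ξ̃(s')·CVaR_{α·ξ̃(s')}[Z | W = s'], where every argument α·ξ̃(s') lies in [0,1] and terms with ξ̃(s') = 0 contribute 0. -/

import Mathlib

open Finset

section CVaRFin

attribute [local instance] Classical.propDecidable

/-- Risk envelope `U_β(p)` for a pmf `p` on a finite type `Ω`. -/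
def RiskEnv {Ω : Type*} [Fintype Ω] (β : ℝ) (p : Ω → ℝ) (ξ : Ω → ℝ) : Prop :=
  (∀ ω, 0 ≤ ξ ω ∧ ξ ω ≤ 1 / β) ∧ ∑ ω, p ω * ξ ω = 1

/-- CVaR at level `β` of a random variable `Z` on a finite probability space `(Ω, Pr)`,
in the dual formulation; by convention `CVaR_0[Z]` is the minimum of `Z` over the
support of `Pr`. -/
noncomputable def cvarFin {Ω : Type*} [Fintype Ω] (Pr : Ω → ℝ) (Z : Ω → ℝ) (β : ℝ) : ℝ :=
  if β = 0 then sInf {x | ∃ ω, 0 < Pr ω ∧ x = Z ω}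
  else sInf {x | ∃ ξ : Ω → ℝ, RiskEnv β Pr ξ ∧ x = ∑ ω, Pr ω * ξ ω * Z ω}

/-- Pushforward pmf `p_W` of `Pr` along `W : Ω → 𝒮`. -/
noncomputable def pushPMF {Ω 𝒮 : Type*} [Fintype Ω] (Pr : Ω → ℝ) (W : Ω → 𝒮) (s' : 𝒮) : ℝ :=
  ∑ ω, if W ω = s' then Pr ω else 0

/-- Conditional pmf `Pr(· | W = s')` on `Ω`. -/
noncomputable def condPMF {Ω 𝒮 : Type*} [Fintype Ω] (Pr : Ω → ℝ) (W : Ω → 𝒮) (s' : 𝒮)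
    (ω : Ω) : ℝ :=
  if W ω = s' then Pr ω / pushPMF Pr W s' else 0

theorem pushPMF_nonneg' {Ω 𝒮 : Type*} [Fintype Ω] (Pr : Ω → ℝ) (hPr : ∀ ω, 0 ≤ Pr ω)
    (W : Ω → 𝒮) (s : 𝒮) : 0 ≤ pushPMF Pr W s := by
  unfold pushPMF
  refine Finset.sum_nonneg fun ω _ => ?_
  split_ifs
  · exact hPr ω
  · exact le_rfl

theorem push_mul_cond {Ω 𝒮 : Type*} [Fintype Ω] (Pr : Ω → ℝ) (hPr : ∀ ω, 0 ≤ Pr ω)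
    (W : Ω → 𝒮) (s : 𝒮) (ω : Ω) :
    pushPMF Pr W s * condPMF Pr W s ω = if W ω = s then Pr ω else 0 := by
  unfold condPMF
  split_ifs with h
  · by_cases h0 : pushPMF Pr W s = 0
    · have h1 := h0
      unfold pushPMF at h1
      rw [Finset.sum_eq_zero_iff_of_nonneg] at h1
      · have := h1 ω (Finset.mem_univ _)
        rw [if_pos h] at this
        rw [h0, this]; simp
      · intro i _
        split_ifs
        · exact hPr i
        · exact le_rfl
    · field_simp
  · simp

theorem sum_fib {Ω 𝒮 : Type*} [Fintype Ω] [Fintype 𝒮] (W : Ω → 𝒮) (f : Ω → ℝ) :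
    ∑ ω, f ω = ∑ s, ∑ ω, if W ω = s then f ω else 0 := by
  rw [Finset.sum_comm]
  simp

theorem cvar_bdd {Ω : Type*} [Fintype Ω] (p Z : Ω → ℝ) (hp : ∀ ω, 0 ≤ p ω) (β : ℝ) :
    BddBelow {x | ∃ ξ : Ω → ℝ, RiskEnv β p ξ ∧ x = ∑ ω, p ω * ξ ω * Z ω} := by
  refine ⟨∑ ω, -(p ω * (1 / β) * |Z ω|), ?_⟩
  rintro x ⟨ξ, hξ, rfl⟩
  refine Finset.sum_le_sum fun ω _ => ?_
  have h1 : p ω * ξ ω * |Z ω| ≤ p ω * (1 / β) * |Z ω| :=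
    mul_le_mul_of_nonneg_right (mul_le_mul_of_nonneg_left (hξ.1 ω).2 (hp ω)) (abs_nonneg _)
  have h2 : p ω * ξ ω * (-|Z ω|) ≤ p ω * ξ ω * Z ω :=
    mul_le_mul_of_nonneg_left (neg_abs_le _) (mul_nonneg (hp ω) (hξ.1 ω).1)
  linarith

theorem cvar_ne {Ω : Type*} [Fintype Ω] (p Z : Ω → ℝ) (hp1 : ∑ ω, p ω = 1) (β : ℝ)
    (h0 : 0 < β) (h1 : β ≤ 1) :
    {x | ∃ ξ : Ω → ℝ, RiskEnv β p ξ ∧ x = ∑ ω, p ω * ξ ω * Z ω}.Nonempty := by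
  refine ⟨_, fun _ => 1, ⟨fun ω => ⟨zero_le_one, ?_⟩, by simpa using hp1⟩, rfl⟩
  rw [le_div_iff₀ h0]; linarith

theorem cond_nonneg' {Ω 𝒮 : Type*} [Fintype Ω] (Pr : Ω → ℝ) (hPr : ∀ ω, 0 ≤ Pr ω)
    (W : Ω → 𝒮) (s : 𝒮) (ω : Ω) : 0 ≤ condPMF Pr W s ω := by
  unfold condPMF
  split_ifs
  · exact div_nonneg (hPr ω) (pushPMF_nonneg' Pr hPr W s)
  · exact le_rfl

theorem cond_sum {Ω 𝒮 : Type*} [Fintype Ω] (Pr : Ω → ℝ) (hPr : ∀ ω, 0 ≤ Pr ω)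
    (W : Ω → 𝒮) (s : 𝒮) (h : 0 < pushPMF Pr W s) : ∑ ω, condPMF Pr W s ω = 1 := by
  have h2 : pushPMF Pr W s * ∑ ω, condPMF Pr W s ω = pushPMF Pr W s * 1 := by
    rw [Finset.mul_sum, mul_one]
    simp_rw [push_mul_cond Pr hPr W s]
    rfl
  exact mul_left_cancel₀ h.ne' h2

theorem env_range {𝒮 : Type*} [Fintype 𝒮] (p ξ : 𝒮 → ℝ) (α : ℝ) (hα0 : 0 < α)
    (h : RiskEnv α p ξ) (s : 𝒮) : 0 ≤ α * ξ s ∧ α * ξ s ≤ 1 := by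
  refine ⟨mul_nonneg hα0.le (h.1 s).1, ?_⟩
  have := (h.1 s).2
  rw [le_div_iff₀ hα0] at this
  linarith

/-- Gluing: conditional densities glue to a global one. -/
theorem cvar_glue {Ω 𝒮 : Type*} [Fintype Ω] [Fintype 𝒮]
    (Pr : Ω → ℝ) (hPr : ∀ ω, 0 ≤ Pr ω)
    (Z : Ω → ℝ) (W : Ω → 𝒮) (α : ℝ) (hα0 : 0 < α) (ξ : 𝒮 → ℝ)
    (hξ : RiskEnv α (pushPMF Pr W) ξ) :
    cvarFin Pr Z α ≤ ∑ s, pushPMF Pr W s * ξ s * cvarFin (condPMF Pr W s) Z (α * ξ s) := by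
  refine le_of_forall_pos_le_add fun ε hε => ?_
  have hex : ∀ s, ∃ η : Ω → ℝ, (∀ ω, 0 ≤ ξ s * η ω ∧ ξ s * η ω ≤ 1 / α) ∧
      pushPMF Pr W s * ξ s * ∑ ω, condPMF Pr W s ω * η ω = pushPMF Pr W s * ξ s ∧
      pushPMF Pr W s * ξ s * ∑ ω, condPMF Pr W s ω * η ω * Z ω ≤
        pushPMF Pr W s * ξ s * (cvarFin (condPMF Pr W s) Z (α * ξ s) + ε) := by
    intro s
    have hr := env_range _ ξ α hα0 hξ s
    have hα' : 0 ≤ 1 / α := by positivity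
    rcases (hξ.1 s).1.eq_or_lt with h0 | h0
    · refine ⟨fun _ => 0, ?_, ?_, ?_⟩ <;> simp [← h0, hα0.le]
    rcases (pushPMF_nonneg' Pr hPr W s).eq_or_lt with hp | hp
    · refine ⟨fun _ => 0, ?_, ?_, ?_⟩ <;> simp [← hp, hα0.le]
    have hpos : 0 < α * ξ s := mul_pos hα0 h0
    obtain ⟨x, ⟨η, hη, rfl⟩, hx⟩ := exists_lt_of_csInf_lt
      (cvar_ne (condPMF Pr W s) Z (cond_sum Pr hPr W s hp) (α * ξ s) hpos hr.2)
      (lt_add_of_pos_right _ hε)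
    refine ⟨η, fun ω => ⟨mul_nonneg h0.le (hη.1 ω).1, ?_⟩, ?_, ?_⟩
    · have := mul_le_mul_of_nonneg_left (hη.1 ω).2 h0.le
      refine this.trans (le_of_eq ?_)
      field_simp
    · rw [hη.2, mul_one]
    · refine mul_le_mul_of_nonneg_left ?_ (mul_nonneg hp.le h0.le)
      unfold cvarFin
      rw [if_neg hpos.ne']
      exact hx.le
  choose η h1 h2 h3 using hex
  have key : ∀ g : Ω → ℝ, ∑ ω, Pr ω * (ξ (W ω) * η (W ω) ω) * g ω =
      ∑ s, pushPMF Pr W s * ξ s * ∑ ω, condPMF Pr W s ω * η s ω * g ω := by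
    intro g
    rw [sum_fib W]
    refine Finset.sum_congr rfl fun s _ => ?_
    rw [Finset.mul_sum]
    refine Finset.sum_congr rfl fun ω _ => ?_
    have := push_mul_cond Pr hPr W s ω
    calc _ = (if W ω = s then Pr ω else 0) * (ξ s * η s ω * g ω) := by
            split_ifs with h
            · subst h; ring
            · ring
      _ = _ := by rw [← this]; ring
  have hle : cvarFin Pr Z α ≤ ∑ ω, Pr ω * (ξ (W ω) * η (W ω) ω) * Z ω := by
    unfold cvarFin
    rw [if_neg hα0.ne']
    refine csInf_le (cvar_bdd Pr Z hPr α) ⟨fun ω => ξ (W ω) * η (W ω) ω, ⟨?_, ?_⟩, rfl⟩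
    · exact fun ω => h1 (W ω) ω
    · have := key (fun _ => 1)
      simp only [mul_one] at this
      rw [this, Finset.sum_congr rfl fun s _ => h2 s]
      exact hξ.2
  rw [key Z] at hle
  refine hle.trans ((Finset.sum_le_sum fun s _ => h3 s).trans (le_of_eq ?_))
  simp_rw [mul_add]
  rw [Finset.sum_add_distrib, ← Finset.sum_mul, hξ.2, one_mul]

/-- Splitting: a global density yields a density on `𝒮` with smaller decomposed value. -/
theorem cvar_split {Ω 𝒮 : Type*} [Fintype Ω] [Fintype 𝒮]
    (Pr : Ω → ℝ) (hPr : ∀ ω, 0 ≤ Pr ω)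
    (Z : Ω → ℝ) (W : Ω → 𝒮) (α : ℝ) (hα0 : 0 < α) (ξ : Ω → ℝ)
    (hξ : RiskEnv α Pr ξ) :
    ∃ ζ : 𝒮 → ℝ, RiskEnv α (pushPMF Pr W) ζ ∧
      ∑ s, pushPMF Pr W s * ζ s * cvarFin (condPMF Pr W s) Z (α * ζ s) ≤
        ∑ ω, Pr ω * ξ ω * Z ω := by
  have hα' : 0 ≤ 1 / α := by positivity
  have key : ∀ (g : Ω → ℝ) (s : 𝒮), (∑ ω, if W ω = s then Pr ω * g ω else 0) =
      pushPMF Pr W s * ∑ ω, condPMF Pr W s ω * g ω := by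
    intro g s
    rw [Finset.mul_sum]
    refine Finset.sum_congr rfl fun ω _ => ?_
    rw [← mul_assoc, push_mul_cond Pr hPr W s ω, ite_mul, zero_mul]
  have hc := cond_nonneg' Pr hPr W
  have hp := pushPMF_nonneg' Pr hPr W
  refine ⟨fun s => ∑ ω, condPMF Pr W s ω * ξ ω, ⟨fun s => ⟨?_, ?_⟩, ?_⟩, ?_⟩
  · exact Finset.sum_nonneg fun ω _ => mul_nonneg (hc s ω) (hξ.1 ω).1
  · rcases (hp s).eq_or_lt with h | h
    · have : ∀ ω, condPMF Pr W s ω = 0 := by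
        intro ω; unfold condPMF; rw [← h]; simp
      simpa [this] using hα0.le
    · calc _ ≤ ∑ ω, condPMF Pr W s ω * (1 / α) :=
            Finset.sum_le_sum fun ω _ => mul_le_mul_of_nonneg_left (hξ.1 ω).2 (hc s ω)
        _ = 1 / α := by rw [← Finset.sum_mul, cond_sum Pr hPr W s h, one_mul]
  · simp_rw [← key]
    rw [← sum_fib W]
    exact hξ.2
  · simp_rw [mul_assoc (Pr _)]
    rw [sum_fib W]
    refine Finset.sum_le_sum fun s _ => ?_
    rw [key (fun ω => ξ ω * Z ω) s, mul_assoc]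
    refine mul_le_mul_of_nonneg_left ?_ (hp s)
    set z := ∑ ω, condPMF Pr W s ω * ξ ω with hz
    have hz0 : 0 ≤ z := Finset.sum_nonneg fun ω _ => mul_nonneg (hc s ω) (hξ.1 ω).1
    rcases hz0.eq_or_lt with h | h
    · rw [← h, zero_mul]
      rw [hz, eq_comm, Finset.sum_eq_zero_iff_of_nonneg
        (fun ω _ => mul_nonneg (hc s ω) (hξ.1 ω).1)] at h
      refine le_of_eq (Finset.sum_eq_zero fun ω hω => ?_).symm
      rw [← mul_assoc, h ω hω, zero_mul]
    · have hle : cvarFin (condPMF Pr W s) Z (α * z) ≤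
          ∑ ω, condPMF Pr W s ω * (ξ ω / z) * Z ω := by
        unfold cvarFin
        rw [if_neg (mul_pos hα0 h).ne']
        refine csInf_le (cvar_bdd _ Z (hc s) _) ⟨fun ω => ξ ω / z, ⟨fun ω => ⟨?_, ?_⟩, ?_⟩, rfl⟩
        · exact div_nonneg (hξ.1 ω).1 h.le
        · rw [← div_div]
          exact div_le_div_of_nonneg_right (hξ.1 ω).2 h.le
        · simp_rw [← mul_div_assoc]
          rw [← Finset.sum_div, ← hz, div_self h.ne']
      refine (mul_le_mul_of_nonneg_left hle h.le).trans (le_of_eq ?_)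
      rw [Finset.mul_sum]
      refine Finset.sum_congr rfl fun ω _ => ?_
      field_simp

/-- CVaR decomposition for finite probability spaces:
let `(Ω, Pr)` be a finite probability space, `Z : Ω → ℝ`, and `W : Ω → 𝒮` a map to a finite
set `𝒮` with pushforward distribution `p_W`. Then for every `α ∈ (0,1]`:
`CVaR_α[Z] = min_{ξ̃ ∈ U_α(p_W)} Σ_{s' : p_W(s') > 0} p_W(s')·ξ̃(s')·CVaR_{α·ξ̃(s')}[Z | W = s']`,
where every argument `α·ξ̃(s')` lies in `[0,1]` and terms with `ξ̃(s') = 0` contribute `0`. -/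
theorem stmt17 {Ω 𝒮 : Type*} [Fintype Ω] [Fintype 𝒮]
    (Pr : Ω → ℝ) (hPr : ∀ ω, 0 ≤ Pr ω) (hPr1 : ∑ ω, Pr ω = 1)
    (Z : Ω → ℝ) (W : Ω → 𝒮)
    (α : ℝ) (hα0 : 0 < α) (hα1 : α ≤ 1) :
    (∀ ξ : 𝒮 → ℝ, RiskEnv α (pushPMF Pr W) ξ →
      ∀ s' : 𝒮, 0 ≤ α * ξ s' ∧ α * ξ s' ≤ 1) ∧
    cvarFin Pr Z α =
      sInf {x | ∃ ξ : 𝒮 → ℝ, RiskEnv α (pushPMF Pr W) ξ ∧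
        x = ∑ s' ∈ Finset.univ.filter (fun s' : 𝒮 => 0 < pushPMF Pr W s'),
          pushPMF Pr W s' * ξ s' * cvarFin (condPMF Pr W s') Z (α * ξ s')} := by
  refine ⟨fun ξ h s => env_range _ ξ α hα0 h s, ?_⟩
  have hfilt : ∀ ξ : 𝒮 → ℝ,
      ∑ s' ∈ Finset.univ.filter (fun s' : 𝒮 => 0 < pushPMF Pr W s'),
          pushPMF Pr W s' * ξ s' * cvarFin (condPMF Pr W s') Z (α * ξ s') =
      ∑ s', pushPMF Pr W s' * ξ s' * cvarFin (condPMF Pr W s') Z (α * ξ s') := by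
    intro ξ
    refine Finset.sum_subset (Finset.subset_univ _) fun s _ hs => ?_
    have h0 : pushPMF Pr W s = 0 := by
      refine le_antisymm (not_lt.1 fun h => hs ?_) (pushPMF_nonneg' Pr hPr W s)
      simpa using h
    rw [h0, zero_mul, zero_mul]
  simp_rw [hfilt]
  have hne := cvar_ne Pr Z hPr1 α hα0 hα1
  apply le_antisymm
  · apply le_csInf
    · obtain ⟨_, ξ, hξ, _⟩ := hne
      obtain ⟨ζ, hζ, _⟩ := cvar_split Pr hPr Z W α hα0 ξ hξ
      exact ⟨_, ζ, hζ, rfl⟩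
    · rintro x ⟨ξ, hξ, rfl⟩
      exact cvar_glue Pr hPr Z W α hα0 ξ hξ
  · have hb : BddBelow {x | ∃ ξ : 𝒮 → ℝ, RiskEnv α (pushPMF Pr W) ξ ∧
        x = ∑ s', pushPMF Pr W s' * ξ s' * cvarFin (condPMF Pr W s') Z (α * ξ s')} := by
      refine ⟨cvarFin Pr Z α, ?_⟩
      rintro x ⟨ξ, hξ, rfl⟩
      exact cvar_glue Pr hPr Z W α hα0 ξ hξ
    conv_rhs => unfold cvarFin
    rw [if_neg hα0.ne']
    apply le_csInf hne
    rintro x ⟨ξ, hξ, rfl⟩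
    obtain ⟨ζ, hζ, hle⟩ := cvar_split Pr hPr Z W α hα0 ξ hξ
    exact (csInf_le hb ⟨ζ, hζ, rfl⟩).trans hle

end CVaRFin
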